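/- arXiv:2502.06763 — 2 statements merged into one kernel-verified Lean document; each statement's English description precedes it below -/
import Mathlib

section
/- For every c > 0, the symmetric matrix (1/N) 𝟏 A Aᵀ 𝟏ᵀ + c J ∈ ℝ^{Nm×Nm} is positive definite. -/
open Matrix

/-- The matrix `𝟏 A ∈ ℝ^{Nm × n}`, where `𝟏 = 1_N ⊗ I_m`: each of the `N` row-blocks is `A`. -/
def oneA (N m n : ℕ) (A : Matrix (Fin m) (Fin n) ℝ) : Matrix (Fin N × Fin m) (Fin n) ℝ :=
  Matrix.of fun ik j => A ik.2 j

/-- The matrix `J = I_{Nm} − (1/N) 𝟏 𝟏ᵀ`, with `𝟏 = 1_N ⊗ I_m`; note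
`(𝟏𝟏ᵀ)_{(i,k),(j,l)} = δ_{k l}`. -/
noncomputable def Jmat (N m : ℕ) : Matrix (Fin N × Fin m) (Fin N × Fin m) ℝ :=
  1 - (N : ℝ)⁻¹ • Matrix.of (fun ik jl : Fin N × Fin m => if ik.2 = jl.2 then (1 : ℝ) else 0)

theorem dotProduct_gram_mulVec {ι κ : Type*} [Fintype ι] [Fintype κ] (B : Matrix ι κ ℝ)
    (x : κ → ℝ) : x ⬝ᵥ ((Bᵀ * B) *ᵥ x) = B *ᵥ x ⬝ᵥ B *ᵥ x := by
  rw [← mulVec_mulVec, dotProduct_mulVec, vecMul_transpose]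

theorem Jmat_mulVec_apply (N m : ℕ) (x : Fin N × Fin m → ℝ) (p : Fin N × Fin m) :
    (Jmat N m *ᵥ x) p = x p - (N : ℝ)⁻¹ * ∑ i, x (i, p.2) := by
  have h : (Matrix.of (fun ik jl : Fin N × Fin m => if ik.2 = jl.2 then (1 : ℝ) else 0) *ᵥ x) p
      = ∑ i, x (i, p.2) := by
    simp [mulVec, dotProduct, Fintype.sum_prod_type]
  rw [Jmat, sub_mulVec, one_mulVec, smul_mulVec, Pi.sub_apply, Pi.smul_apply, h, smul_eq_mul]

theorem Jmat_transpose (N m : ℕ) : (Jmat N m)ᵀ = Jmat N m := by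
  ext p q
  simp [Jmat, Matrix.one_apply, eq_comm]

theorem Jmat_mul_self {N : ℕ} (hN : N ≠ 0) (m : ℕ) : Jmat N m * Jmat N m = Jmat N m := by
  refine ext_of_mulVec_single fun q => ?_
  generalize (Pi.single q 1 : Fin N × Fin m → ℝ) = x
  have hN' : (N : ℝ) ≠ 0 := Nat.cast_ne_zero.mpr hN
  ext p
  rw [← mulVec_mulVec, Jmat_mulVec_apply]
  simp [Jmat_mulVec_apply, mul_inv_cancel_left₀ hN']

theorem oneA_transpose_mulVec (N m n : ℕ) (A : Matrix (Fin m) (Fin n) ℝ)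
    (x : Fin N × Fin m → ℝ) :
    (oneA N m n A)ᵀ *ᵥ x = Aᵀ *ᵥ fun k => ∑ i, x (i, k) := by
  ext j
  simp only [mulVec, dotProduct, oneA, transpose_apply, of_apply, Fintype.sum_prod_type,
    Finset.mul_sum]
  exact Finset.sum_comm

/-- if `A` has full row rank then, for every `c > 0`, the symmetric matrix
`(1/N) 𝟏 A Aᵀ 𝟏ᵀ + c J` is positive definite. -/
theorem stmt_7
    (N m n : ℕ) (hN : 1 ≤ N)
    (nn : Fin N → ℕ) (hnn : ∀ i, 1 ≤ nn i) (hn : n = ∑ i, nn i)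
    (A : Matrix (Fin m) (Fin n) ℝ)
    (hA : ∀ y : Fin m → ℝ, Aᵀ.mulVec y = 0 → y = 0)  -- full row rank
    (c : ℝ) (hc : 0 < c) :
    ((N : ℝ)⁻¹ • (oneA N m n A * (oneA N m n A)ᵀ) + c • Jmat N m).PosDef := by
  have hN0 : 0 < (N : ℝ)⁻¹ := by positivity
  have hJ : Jmat N m = (Jmat N m)ᵀ * Jmat N m := by
    rw [Jmat_transpose, Jmat_mul_self (by omega)]
  have quad : ∀ x : Fin N × Fin m → ℝ,
      x ⬝ᵥ (((N : ℝ)⁻¹ • (oneA N m n A * (oneA N m n A)ᵀ) + c • Jmat N m) *ᵥ x) =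
        (N : ℝ)⁻¹ * ((oneA N m n A)ᵀ *ᵥ x ⬝ᵥ (oneA N m n A)ᵀ *ᵥ x) +
          c * (Jmat N m *ᵥ x ⬝ᵥ Jmat N m *ᵥ x) := by
    intro x
    rw [add_mulVec, smul_mulVec, smul_mulVec, dotProduct_add, dotProduct_smul, dotProduct_smul,
      smul_eq_mul, smul_eq_mul, ← dotProduct_gram_mulVec, ← dotProduct_gram_mulVec, ← hJ,
      transpose_transpose]
  refine PosDef.of_dotProduct_mulVec_pos ?_ fun x hx => ?_
  · simp [IsHermitian, conjTranspose_eq_transpose_of_trivial, transpose_mul, Jmat_transpose]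
  rw [star_trivial, quad]
  have h1 : 0 ≤ (oneA N m n A)ᵀ *ᵥ x ⬝ᵥ (oneA N m n A)ᵀ *ᵥ x :=
    Finset.sum_nonneg fun i _ => mul_self_nonneg _
  have h2 : 0 ≤ Jmat N m *ᵥ x ⬝ᵥ Jmat N m *ᵥ x :=
    Finset.sum_nonneg fun i _ => mul_self_nonneg _
  rcases h1.lt_or_eq with h1' | h1'
  · positivity
  rcases h2.lt_or_eq with h2' | h2'
  · positivity
  have hS := hA _ ((oneA_transpose_mulVec N m n A x).symm.trans
    (dotProduct_self_eq_zero.mp h1'.symm))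
  refine absurd (funext fun p => ?_) hx
  have hp := congrFun (dotProduct_self_eq_zero.mp h2'.symm) p
  have hSp : ∑ i, x (i, p.2) = 0 := congrFun hS p.2
  rw [Jmat_mulVec_apply, hSp] at hp
  simpa using hp
end

section
/- There exists p̄ > 0 such that for every p > p̄ there exists q > 0 with the following property: for every symmetric matrix H ∈ ℝ^{n×n} satisfying μ I_n ⪯ H ⪯ c I_n, the matrix 𝓖(H)ᵀ P(p) + P(p) 𝓖(H) ⪯ −q I_{n+Nm} (i.e., q I + 𝓖(H)ᵀP(p) + P(p)𝓖(H) is negative semidefinite), where 𝓖(H) = [[−H, −(1/N)Aᵀ𝟏ᵀ], [(1/N)𝟏A, −κJ]] and P(p) = [[p I_n, (1/N)Aᵀ𝟏ᵀ], [(1/N)𝟏A, p I_{Nm}]]. -/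
open Matrix

/-- The block matrix `P(p) = [[p Iₙ, (1/N) Aᵀ𝟏ᵀ], [(1/N) 𝟏A, p I_{Nm}]]`. -/
noncomputable def Pmat (N m n : ℕ) (A : Matrix (Fin m) (Fin n) ℝ) (p : ℝ) :
    Matrix (Fin n ⊕ Fin N × Fin m) (Fin n ⊕ Fin N × Fin m) ℝ :=
  Matrix.fromBlocks (p • 1) ((N : ℝ)⁻¹ • (oneA N m n A)ᵀ) ((N : ℝ)⁻¹ • oneA N m n A) (p • 1)

/-- The block matrix `𝓖(H) = [[−H, −(1/N) Aᵀ𝟏ᵀ], [(1/N) 𝟏A, −κ J]]`. -/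
noncomputable def Gmat (N m n : ℕ) (A : Matrix (Fin m) (Fin n) ℝ) (κ : ℝ)
    (H : Matrix (Fin n) (Fin n) ℝ) :
    Matrix (Fin n ⊕ Fin N × Fin m) (Fin n ⊕ Fin N × Fin m) ℝ :=
  Matrix.fromBlocks (-H) (-((N : ℝ)⁻¹ • (oneA N m n A)ᵀ)) ((N : ℝ)⁻¹ • oneA N m n A)
    (-(κ • Jmat N m))

theorem exists_mulVec_dotProduct_self_le {ι κ : Type*} [Fintype ι] [Fintype κ]
    (M : Matrix ι κ ℝ) :
    ∃ β > (0 : ℝ), ∀ x : κ → ℝ, (M *ᵥ x) ⬝ᵥ (M *ᵥ x) ≤ β * (x ⬝ᵥ x) := by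
  refine ⟨(∑ i, ∑ j, M i j ^ 2) + 1, by positivity, fun x => ?_⟩
  have hx : x ⬝ᵥ x = ∑ j, x j ^ 2 := by simp [dotProduct, sq]
  have h : (M *ᵥ x) ⬝ᵥ (M *ᵥ x) ≤ ∑ i, (∑ j, M i j ^ 2) * ∑ j, x j ^ 2 := by
    refine Finset.sum_le_sum fun i _ => ?_
    rw [← sq]
    exact Finset.sum_mul_sq_le_sq_mul_sq _ _ _
  rw [← Finset.sum_mul] at h
  have hx0 : 0 ≤ ∑ j, x j ^ 2 := by positivity
  rw [hx]
  linarith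

theorem exists_le_mulVec_dotProduct_self {ι κ : Type*} [Fintype ι] [Fintype κ] [DecidableEq ι]
    [DecidableEq κ] (M : Matrix ι κ ℝ) (hM : ∀ x, M *ᵥ x = 0 → x = 0) :
    ∃ α > (0 : ℝ), ∀ x : κ → ℝ, α * (x ⬝ᵥ x) ≤ (M *ᵥ x) ⬝ᵥ (M *ᵥ x) := by
  obtain ⟨L, hL⟩ := M.mulVecLin.exists_leftInverse_of_injective
    (LinearMap.ker_eq_bot'.2 fun x hx => hM x hx)
  obtain ⟨β, hβ, h⟩ := exists_mulVec_dotProduct_self_le (LinearMap.toMatrix' L)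
  refine ⟨β⁻¹, inv_pos.2 hβ, fun x => ?_⟩
  have hx : LinearMap.toMatrix' L *ᵥ (M *ᵥ x) = x := by
    rw [LinearMap.toMatrix'_mulVec]
    exact LinearMap.congr_fun hL x
  have := h (M *ᵥ x)
  rw [hx] at this
  rwa [inv_mul_le_iff₀ hβ]

theorem mulVec_dotProduct_self_le_mul {ι : Type*} [Fintype ι] [DecidableEq ι]
    {H : Matrix ι ι ℝ} {c : ℝ} (hc : 0 < c) (hS : H.IsSymm) (h0 : ∀ x, 0 ≤ x ⬝ᵥ H *ᵥ x)
    (h1 : ∀ x, x ⬝ᵥ H *ᵥ x ≤ c * (x ⬝ᵥ x)) (x : ι → ℝ) :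
    (H *ᵥ x) ⬝ᵥ (H *ᵥ x) ≤ c * (x ⬝ᵥ H *ᵥ x) := by
  set z := H *ᵥ x with hz
  have hxz : x ⬝ᵥ H *ᵥ z = z ⬝ᵥ z := by
    rw [dotProduct_mulVec, ← mulVec_transpose, hS.eq]
  have h := h0 (c • x - z)
  have h2 := h1 z
  simp only [mulVec_sub, mulVec_smul, dotProduct_sub, sub_dotProduct, smul_dotProduct,
    dotProduct_smul, smul_eq_mul, hxz, ← hz] at h
  have : 0 ≤ c * (c * (x ⬝ᵥ z) - z ⬝ᵥ z) := by linarith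
  have := nonneg_of_mul_nonneg_right this hc
  linarith

/-- The average over the `N` blocks of a block vector. -/
noncomputable def blockMean {N m : ℕ} (y : Fin N × Fin m → ℝ) (k : Fin m) : ℝ :=
  (N : ℝ)⁻¹ * ∑ i, y (i, k)

theorem oneA_mulVec {N m n : ℕ} (A : Matrix (Fin m) (Fin n) ℝ) (x : Fin n → ℝ) :
    oneA N m n A *ᵥ x = fun ik => (A *ᵥ x) ik.2 := rfl

theorem smul_oneA_transpose_mulVec {N m n : ℕ} (A : Matrix (Fin m) (Fin n) ℝ)
    (y : Fin N × Fin m → ℝ) :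
    ((N : ℝ)⁻¹ • (oneA N m n A)ᵀ) *ᵥ y = Aᵀ *ᵥ blockMean y := by
  ext j
  simp only [mulVec, dotProduct, transpose_apply, Matrix.smul_apply, smul_eq_mul, oneA,
    of_apply, blockMean, Fintype.sum_prod_type_right, Finset.mul_sum]
  exact Finset.sum_congr rfl fun k _ => Finset.sum_congr rfl fun i _ => by ring

theorem Jmat_mulVec {N m : ℕ} (y : Fin N × Fin m → ℝ) :
    Jmat N m *ᵥ y = fun ik => y ik - blockMean y ik.2 := by
  ext ⟨i, k⟩
  rw [Jmat, sub_mulVec, smul_mulVec, one_mulVec]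
  simp [mulVec, dotProduct, blockMean, Fintype.sum_prod_type]

theorem dotProduct_comp_snd {N m : ℕ} (y : Fin N × Fin m → ℝ) (v : Fin m → ℝ) (hN : 1 ≤ N) :
    y ⬝ᵥ (fun ik => v ik.2) = N * (blockMean y ⬝ᵥ v) := by
  have : (N : ℝ) ≠ 0 := by positivity
  simp only [dotProduct, Fintype.sum_prod_type_right, blockMean, Finset.mul_sum, ← Finset.sum_mul]
  refine Finset.sum_congr rfl fun k _ => ?_
  rw [← Finset.mul_sum]
  field_simp

theorem blockMean_comp_snd {N m : ℕ} (v : Fin m → ℝ) (hN : 1 ≤ N) :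
    blockMean (fun ik : Fin N × Fin m => v ik.2) = v := by
  have : (N : ℝ) ≠ 0 := by positivity
  ext k
  simp [blockMean, this]

theorem dotProduct_Jmat_mulVec {N m : ℕ} (y : Fin N × Fin m → ℝ) (hN : 1 ≤ N) :
    y ⬝ᵥ Jmat N m *ᵥ y = y ⬝ᵥ y - N * (blockMean y ⬝ᵥ blockMean y) := by
  rw [Jmat_mulVec, ← dotProduct_comp_snd y _ hN, ← dotProduct_sub]
  rfl

theorem mul_blockMean_dotProduct_self_le {N m : ℕ} (y : Fin N × Fin m → ℝ) (hN : 1 ≤ N) :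
    N * (blockMean y ⬝ᵥ blockMean y) ≤ y ⬝ᵥ y := by
  set u : Fin N × Fin m → ℝ := fun ik => blockMean y ik.2 with hu
  have h : 0 ≤ (y - u) ⬝ᵥ (y - u) := Finset.sum_nonneg fun i _ => mul_self_nonneg _
  have h1 : y ⬝ᵥ u = N * (blockMean y ⬝ᵥ blockMean y) := dotProduct_comp_snd y _ hN
  have h2 : u ⬝ᵥ u = N * (blockMean y ⬝ᵥ blockMean y) := by
    rw [hu, dotProduct_comp_snd _ _ hN, blockMean_comp_snd _ hN]
  rw [dotProduct_sub, sub_dotProduct, sub_dotProduct, dotProduct_comm u y, h1, h2] at h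
  linarith

theorem comp_snd_dotProduct_Jmat_mulVec {N m : ℕ} (v : Fin m → ℝ) (y : Fin N × Fin m → ℝ)
    (hN : 1 ≤ N) : (fun ik => v ik.2) ⬝ᵥ Jmat N m *ᵥ y = 0 := by
  set u : Fin N × Fin m → ℝ := fun ik => blockMean y ik.2 with hu
  have : Jmat N m *ᵥ y = y - u := Jmat_mulVec y
  rw [this, dotProduct_sub, dotProduct_comm _ y, dotProduct_comp_snd y v hN, hu,
    dotProduct_comp_snd _ _ hN, blockMean_comp_snd _ hN, dotProduct_comm v, sub_self]

theorem Pmat_isSymm (N m n : ℕ) (A : Matrix (Fin m) (Fin n) ℝ) (p : ℝ) :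
    (Pmat N m n A p).IsSymm := by
  simp [Matrix.IsSymm, Pmat, fromBlocks_transpose]

theorem Pmat_mulVec_dotProduct_Gmat_mulVec {N m n : ℕ} (hN : 1 ≤ N)
    (A : Matrix (Fin m) (Fin n) ℝ) (κ p : ℝ) (H : Matrix (Fin n) (Fin n) ℝ) (x : Fin n → ℝ)
    (y : Fin N × Fin m → ℝ) :
    (Pmat N m n A p *ᵥ Sum.elim x y) ⬝ᵥ (Gmat N m n A κ H *ᵥ Sum.elim x y) =
      -p * (x ⬝ᵥ H *ᵥ x) - (Aᵀ *ᵥ blockMean y) ⬝ᵥ (H *ᵥ x)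
        - (Aᵀ *ᵥ blockMean y) ⬝ᵥ (Aᵀ *ᵥ blockMean y)
        + (N : ℝ)⁻¹ * ((A *ᵥ x) ⬝ᵥ (A *ᵥ x))
        - p * κ * (y ⬝ᵥ y - N * (blockMean y ⬝ᵥ blockMean y)) := by
  have hN0 : (N : ℝ) ≠ 0 := by positivity
  set b : Fin N × Fin m → ℝ := oneA N m n A *ᵥ x with hb
  have hbb : b ⬝ᵥ b = N * ((A *ᵥ x) ⬝ᵥ (A *ᵥ x)) := by
    rw [hb, oneA_mulVec, dotProduct_comp_snd _ _ hN, blockMean_comp_snd _ hN]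
  have hbJ : b ⬝ᵥ Jmat N m *ᵥ y = 0 := by
    rw [hb, oneA_mulVec, comp_snd_dotProduct_Jmat_mulVec _ _ hN]
  have hyb : y ⬝ᵥ b = N * (x ⬝ᵥ Aᵀ *ᵥ blockMean y) := by
    rw [hb, oneA_mulVec, dotProduct_comp_snd _ _ hN, mulVec_transpose, dotProduct_comm x,
      dotProduct_mulVec]
  simp only [Pmat, Gmat, fromBlocks_mulVec, Sum.elim_comp_inl, Sum.elim_comp_inr,
    sumElim_dotProduct_sumElim, neg_mulVec, smul_oneA_transpose_mulVec]
  simp only [smul_mulVec, one_mulVec, ← hb, add_dotProduct, dotProduct_add, smul_dotProduct,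
    dotProduct_smul, dotProduct_neg, smul_eq_mul, hbJ, dotProduct_Jmat_mulVec y hN, hbb, hyb]
  field_simp
  ring

/-- there exists `p̄ > 0` such that for every `p > p̄` there is `q > 0` with
`𝓖(H)ᵀ P(p) + P(p) 𝓖(H) ⪯ −q I` for every symmetric `H` with `μ I ⪯ H ⪯ c I`. -/
theorem stmt_8
    (N m n : ℕ) (hN : 1 ≤ N)
    (nn : Fin N → ℕ) (hnn : ∀ i, 1 ≤ nn i) (hn : n = ∑ i, nn i)
    (A : Matrix (Fin m) (Fin n) ℝ)
    (hA : ∀ y : Fin m → ℝ, Aᵀ.mulVec y = 0 → y = 0)  -- full row rank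
    (μ c κ : ℝ) (hμ : 0 < μ) (hc : 0 < c) (hμc : μ ≤ c) (hκ : 0 < κ) :
    ∃ pbar > (0 : ℝ), ∀ p : ℝ, pbar < p → ∃ q > (0 : ℝ),
      ∀ H : Matrix (Fin n) (Fin n) ℝ, H.IsSymm →
        (H - μ • 1).PosSemidef → (c • 1 - H).PosSemidef →
        (-(q • 1 + (Gmat N m n A κ H)ᵀ * Pmat N m n A p +
            Pmat N m n A p * Gmat N m n A κ H)).PosSemidef := by
  classical
  obtain ⟨α, hα, hAα⟩ := exists_le_mulVec_dotProduct_self Aᵀ hA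
  obtain ⟨β, hβ, hAβ⟩ := exists_mulVec_dotProduct_self_le A
  have hN0 : (0 : ℝ) < N := by exact_mod_cast hN
  refine ⟨c / 2 + β / (N * μ), by positivity, fun p hp => ?_⟩
  have hp0 : 0 < p := lt_trans (by positivity) hp
  have hpp := sub_pos.2 hp
  set δ := p - (c / 2 + β / (N * μ)) with hδ
  obtain ⟨r, hr, hr1, hr2, hr3⟩ : ∃ r > 0, r ≤ δ * μ ∧ r ≤ α / (2 * N) ∧ r ≤ p * κ :=
    ⟨min (δ * μ) (min (α / (2 * N)) (p * κ)), by positivity, min_le_left _ _,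
      (min_le_right _ _).trans (min_le_left _ _), (min_le_right _ _).trans (min_le_right _ _)⟩
  refine ⟨2 * r, by positivity, fun H hH hHμ hHc => ?_⟩
  have hlow : ∀ x, μ * (x ⬝ᵥ x) ≤ x ⬝ᵥ H *ᵥ x := fun x => by
    have := hHμ.dotProduct_mulVec_nonneg x
    simp only [star_trivial, sub_mulVec, smul_mulVec, one_mulVec, dotProduct_sub, dotProduct_smul,
      smul_eq_mul] at this
    linarith
  have hupp : ∀ x, x ⬝ᵥ H *ᵥ x ≤ c * (x ⬝ᵥ x) := fun x => by
    have := hHc.dotProduct_mulVec_nonneg x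
    simp only [star_trivial, sub_mulVec, smul_mulVec, one_mulVec, dotProduct_sub, dotProduct_smul,
      smul_eq_mul] at this
    linarith
  have hself : ∀ {ι : Type} [Fintype ι] (x : ι → ℝ), 0 ≤ x ⬝ᵥ x := fun x =>
    Finset.sum_nonneg fun i _ => mul_self_nonneg _
  have hsq := mulVec_dotProduct_self_le_mul hc hH
    (fun x => (mul_nonneg hμ.le (hself x)).trans (hlow x)) hupp
  have hP := (Pmat_isSymm N m n A p).eq
  refine PosSemidef.of_dotProduct_mulVec_nonneg ?_ fun w => ?_
  · rw [IsHermitian, conjTranspose_eq_transpose_of_trivial]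
    simp only [transpose_neg, transpose_add, transpose_mul, transpose_smul, transpose_one,
      transpose_transpose, hP]
    abel
  obtain ⟨x, y, rfl⟩ : ∃ x y, w = Sum.elim x y := ⟨_, _, (Sum.elim_comp_inl_inr w).symm⟩
  have key := Pmat_mulVec_dotProduct_Gmat_mulVec hN A κ p H x y
  set w := Sum.elim x y with hw
  have hww : w ⬝ᵥ w = x ⬝ᵥ x + y ⬝ᵥ y := sumElim_dotProduct_sumElim ..
  have e1 : w ⬝ᵥ ((Gmat N m n A κ H)ᵀ * Pmat N m n A p) *ᵥ w =
      (Pmat N m n A p *ᵥ w) ⬝ᵥ (Gmat N m n A κ H *ᵥ w) := by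
    rw [← mulVec_mulVec, dotProduct_mulVec, vecMul_transpose, dotProduct_comm]
  have e2 : w ⬝ᵥ (Pmat N m n A p * Gmat N m n A κ H) *ᵥ w =
      (Pmat N m n A p *ᵥ w) ⬝ᵥ (Gmat N m n A κ H *ᵥ w) := by
    rw [← mulVec_mulVec, dotProduct_mulVec, ← mulVec_transpose, hP]
  simp only [star_trivial, neg_mulVec, add_mulVec, smul_mulVec, one_mulVec, dotProduct_neg,
    dotProduct_add, dotProduct_smul, smul_eq_mul, e1, e2, key, hww]
  have hcross : 0 ≤ (Aᵀ *ᵥ blockMean y + H *ᵥ x) ⬝ᵥ (Aᵀ *ᵥ blockMean y + H *ᵥ x) := hself _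
  rw [dotProduct_add, add_dotProduct, add_dotProduct, dotProduct_comm (H *ᵥ x) (Aᵀ *ᵥ _)]
    at hcross
  have hAx : (N : ℝ)⁻¹ * ((A *ᵥ x) ⬝ᵥ (A *ᵥ x)) ≤ β / (N * μ) * (x ⬝ᵥ H *ᵥ x) := by
    calc _ ≤ (N : ℝ)⁻¹ * (β * (x ⬝ᵥ x)) := by gcongr; exact hAβ x
      _ = β / (N * μ) * (μ * (x ⬝ᵥ x)) := by field_simp
      _ ≤ _ := by gcongr; exact hlow x
  have hx : r * (x ⬝ᵥ x) ≤ δ * (x ⬝ᵥ H *ᵥ x) :=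
    calc _ ≤ δ * μ * (x ⬝ᵥ x) := mul_le_mul_of_nonneg_right hr1 (hself x)
      _ = δ * (μ * (x ⬝ᵥ x)) := by ring
      _ ≤ _ := by gcongr; exact hlow x
  have hy1 : r * (N * (blockMean y ⬝ᵥ blockMean y)) ≤
      (Aᵀ *ᵥ blockMean y) ⬝ᵥ (Aᵀ *ᵥ blockMean y) / 2 :=
    calc _ ≤ α / (2 * N) * (N * (blockMean y ⬝ᵥ blockMean y)) :=
          mul_le_mul_of_nonneg_right hr2 (mul_nonneg hN0.le (hself _))
      _ = α * (blockMean y ⬝ᵥ blockMean y) / 2 := by field_simp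
      _ ≤ _ := by gcongr; exact hAα _
  have hy2 := mul_le_mul_of_nonneg_right hr3
    (sub_nonneg.2 (mul_blockMean_dotProduct_self_le y hN))
  have hHx := hsq x
  have hδx : δ * (x ⬝ᵥ H *ᵥ x) =
      p * (x ⬝ᵥ H *ᵥ x) - c * (x ⬝ᵥ H *ᵥ x) / 2 - β / (N * μ) * (x ⬝ᵥ H *ᵥ x) := by
    rw [hδ]; ring
  linarith
end
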